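/- Let l₁, l₂, l₃, l₄ be four distinct lines in Pic S₈ that pairwise intersect in 1 and form an uncornered A₃⁸(1)-polytope, and let l_a, l_b be lines with l_a·l_b = 0 and l₁ + l₂ + l₃ + K = l_a + l_b. Then the five lines l₁, l₂, l₃, G_{l_a}(l_b), l₄ are distinct and pairwise intersect in 1, i.e., they form an A₄⁸(1)-polytope. -/

import Mathlib

/-!
Picard lattice of the degree 1 del Pezzo surface S₈:
Pic S₈ = ℤh ⊕ ℤe₁ ⊕ ⋯ ⊕ ℤe₈ ≅ ℤ⁹, with intersection pairing
h·h = 1, h·eᵢ = 0, eᵢ·eⱼ = −δᵢⱼ, and canonical class K = −3h + e₁ + ⋯ + e₈.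
-/

namespace DelPezzo

/-- The Picard lattice `Pic S₈ ≅ ℤ⁹`; coordinate `0` is the `h`-coordinate and
coordinates `1,…,8` are the `e₁,…,e₈`-coordinates. -/
abbrev Pic : Type := Fin 9 → ℤ

/-- The intersection pairing on `Pic S₈` (signature `(1,-8)`). -/
def inter (x y : Pic) : ℤ := x 0 * y 0 - ∑ i : Fin 8, x i.succ * y i.succ

/-- The canonical class `K = -3h + e₁ + ⋯ + e₈`. -/
def K : Pic := fun i => if i = 0 then -3 else 1

/-- A line: a class `l` with `l·l = -1` and `l·K = -1`. -/
def IsLine (l : Pic) : Prop := inter l l = -1 ∧ inter l K = -1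

/-- For lines `l, l'` with `l·l' = 0`, the Gieser transform of `l'` for `l`. -/
def G (l l' : Pic) : Pic := -K + l - l'

lemma inter_comm (x y : Pic) : inter x y = inter y x := by
  simp only [inter, mul_comm]

lemma inter_add_left (x y z : Pic) : inter (x + y) z = inter x z + inter y z := by
  simp only [inter, Pi.add_apply, add_mul, Finset.sum_add_distrib]
  ring

lemma inter_neg_left (x z : Pic) : inter (-x) z = -inter x z := by
  simp only [inter, Pi.neg_apply, neg_mul, Finset.sum_neg_distrib]
  ring

lemma inter_sub_left (x y z : Pic) : inter (x - y) z = inter x z - inter y z := by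
  rw [sub_eq_add_neg, inter_add_left, inter_neg_left, sub_eq_add_neg]

lemma inter_sub_right (x y z : Pic) : inter x (y - z) = inter x y - inter x z := by
  rw [inter_comm, inter_sub_left, inter_comm y, inter_comm z]

lemma inter_K_K : inter K K = 1 := by decide

/-- The intersection form is negative definite on the orthogonal complement of `K`. -/
lemma inter_self_neg {x : Pic} (hK : inter x K = 0) (hx : x ≠ 0) : inter x x < 0 := by
  have hsum : 3 * x 0 = -∑ i : Fin 8, x i.succ := by
    simp only [inter, K, ↓reduceIte, Fin.succ_ne_zero, mul_one] at hK
    linarith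
  have hcs := sq_sum_le_card_mul_sum_sq (s := Finset.univ) (f := fun i : Fin 8 => x i.succ)
  simp only [Finset.card_univ, Fintype.card_fin, Nat.cast_ofNat] at hcs
  have hnonneg : 0 ≤ ∑ i : Fin 8, x i.succ ^ 2 := Finset.sum_nonneg fun i _ => sq_nonneg _
  have hpos : ∑ i : Fin 8, x i.succ ^ 2 ≠ 0 := by
    intro h0
    have hi : ∀ i : Fin 8, x i.succ = 0 := fun i => by
      simpa using (Finset.sum_eq_zero_iff_of_nonneg fun i _ => sq_nonneg (x (Fin.succ i))).1 h0 i
        (Finset.mem_univ i)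
    refine hx (funext fun i => ?_)
    cases i using Fin.cases with
    | zero => simpa [hi] using hsum
    | succ i => exact hi i
  have hsq : 9 * x 0 ^ 2 = (∑ i : Fin 8, x i.succ) ^ 2 := by
    rw [← neg_sq (∑ i : Fin 8, x i.succ), ← hsum]
    ring
  simp only [inter, ← sq]
  omega

lemma IsLine.inter_nonneg {x y : Pic} (hx : IsLine x) (hy : IsLine y) (hne : x ≠ y) :
    0 ≤ inter x y := by
  have h := inter_self_neg (x := x - y) (by rw [inter_sub_left, hx.2, hy.2, sub_self])
    (sub_ne_zero.2 hne)
  rw [inter_sub_left, inter_sub_right, inter_sub_right, inter_comm y x, hx.1, hy.1] at h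
  omega

/-- If two disjoint lines have sum orthogonal to a line, each of them is. -/
lemma inter_eq_zero_of_add_eq_zero {a b l : Pic} (ha : IsLine a) (hb : IsLine b) (hl : IsLine l)
    (hab : inter a b = 0) (h : inter a l + inter b l = 0) : inter a l = 0 ∧ inter b l = 0 := by
  have hal : a ≠ l := by
    rintro rfl
    rw [ha.1, inter_comm, hab] at h
    omega
  have hbl : b ≠ l := by
    rintro rfl
    rw [hb.1, hab] at h
    omega
  have := ha.inter_nonneg hl hal
  have := hb.inter_nonneg hl hbl
  omega

lemma inter_G_left (a b l : Pic) : inter (G a b) l = -inter K l + inter a l - inter b l := by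
  rw [G, inter_sub_left, inter_add_left, inter_neg_left]

/-- The Gieser transform of a line is a line. -/
lemma isLine_G {a b : Pic} (ha : IsLine a) (hb : IsLine b) (hab : inter a b = 0) :
    IsLine (G a b) := by
  have hK : inter (G a b) K = -1 := by
    rw [inter_G_left, inter_K_K, ha.2, hb.2]
    norm_num
  refine ⟨?_, hK⟩
  rw [inter_G_left, inter_comm K, hK, inter_comm a, inter_comm b, inter_G_left, inter_G_left,
    inter_comm K, inter_comm K, inter_comm b a, ha.1, ha.2, hb.1, hb.2, hab]
  norm_num

theorem uncornered_extends_to_four_simplex (l₁ l₂ l₃ l₄ la lb : Pic)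
    (h₁ : IsLine l₁) (h₂ : IsLine l₂) (h₃ : IsLine l₃) (h₄ : IsLine l₄)
    (hne : l₁ ≠ l₂ ∧ l₁ ≠ l₃ ∧ l₁ ≠ l₄ ∧ l₂ ≠ l₃ ∧ l₂ ≠ l₄ ∧ l₃ ≠ l₄)
    (h₁₂ : inter l₁ l₂ = 1) (h₁₃ : inter l₁ l₃ = 1) (h₁₄ : inter l₁ l₄ = 1)
    (h₂₃ : inter l₂ l₃ = 1) (h₂₄ : inter l₂ l₄ = 1) (h₃₄ : inter l₃ l₄ = 1)
    (huncor : ¬ ∃ m : Pic, IsLine m ∧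
      inter m l₁ = 0 ∧ inter m l₂ = 0 ∧ inter m l₃ = 0 ∧ inter m l₄ = 0)
    (hla : IsLine la) (hlb : IsLine lb) (hab : inter la lb = 0)
    (hsum : l₁ + l₂ + l₃ + K = la + lb) :
    Function.Injective ![l₁, l₂, l₃, G la lb, l₄] ∧
    (∀ i, IsLine (![l₁, l₂, l₃, G la lb, l₄] i)) ∧
    (∀ i j, i ≠ j →
      inter (![l₁, l₂, l₃, G la lb, l₄] i) (![l₁, l₂, l₃, G la lb, l₄] j) = 1) := by
  have hS : ∀ l, inter la l + inter lb l = inter l₁ l + inter l₂ l + inter l₃ l + inter l K := by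
    intro l
    rw [← inter_add_left, ← hsum, inter_add_left, inter_add_left, inter_add_left, inter_comm K]
  obtain ⟨ha₁, hb₁⟩ := inter_eq_zero_of_add_eq_zero hla hlb h₁ hab (by
    rw [hS, h₁.1, h₁.2, inter_comm l₂, inter_comm l₃, h₁₂, h₁₃]
    norm_num)
  obtain ⟨ha₂, hb₂⟩ := inter_eq_zero_of_add_eq_zero hla hlb h₂ hab (by
    rw [hS, h₂.1, h₂.2, inter_comm l₃, h₁₂, h₂₃]
    norm_num)
  obtain ⟨ha₃, hb₃⟩ := inter_eq_zero_of_add_eq_zero hla hlb h₃ hab (by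
    rw [hS, h₃.1, h₃.2, h₁₃, h₂₃]
    norm_num)
  have hS₄ : inter la l₄ + inter lb l₄ = 2 := by
    rw [hS, h₄.2, h₁₄, h₂₄, h₃₄]
    norm_num
  have hpos : ∀ m, IsLine m → inter m l₁ = 0 → inter m l₂ = 0 → inter m l₃ = 0 →
      0 < inter m l₄ := by
    intro m hm hm₁ hm₂ hm₃
    have hne₄ : m ≠ l₄ := by
      rintro rfl
      rw [inter_comm, h₁₄] at hm₁
      omega
    exact lt_of_le_of_ne (hm.inter_nonneg h₄ hne₄)
      fun h => huncor ⟨m, hm, hm₁, hm₂, hm₃, h.symm⟩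
  have ha₄ := hpos la hla ha₁ ha₂ ha₃
  have hb₄ := hpos lb hlb hb₁ hb₂ hb₃
  have hG : ∀ l, IsLine l → inter la l = inter lb l → inter (G la lb) l = 1 := by
    intro l hl h
    rw [inter_G_left, inter_comm K, hl.2, h]
    ring
  have hG₁ := hG l₁ h₁ (ha₁.trans hb₁.symm)
  have hG₂ := hG l₂ h₂ (ha₂.trans hb₂.symm)
  have hG₃ := hG l₃ h₃ (ha₃.trans hb₃.symm)
  have hG₄ := hG l₄ h₄ (by omega)
  have hlines : ∀ i, IsLine (![l₁, l₂, l₃, G la lb, l₄] i) := by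
    intro i
    fin_cases i
    exacts [h₁, h₂, h₃, isLine_G hla hlb hab, h₄]
  have hinter : ∀ i j, i ≠ j →
      inter (![l₁, l₂, l₃, G la lb, l₄] i) (![l₁, l₂, l₃, G la lb, l₄] j) = 1 := by
    intro i j hij
    wlog hlt : i < j generalizing i j
    · rw [inter_comm]
      exact this j i hij.symm (lt_of_le_of_ne (not_lt.1 hlt) hij.symm)
    rw [inter_comm] at hG₁ hG₂ hG₃
    fin_cases i <;> fin_cases j <;> first | assumption | exact absurd hlt (by decide)
  refine ⟨fun i j hij => ?_, hlines, hinter⟩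
  by_contra hne'
  have h := hinter i j hne'
  rw [← hij, (hlines i).1] at h
  omega

end DelPezzo
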